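/- arXiv:1403.2634 — 3 statements merged into one kernel-verified Lean document; each statement's English description precedes it below -/
import Mathlib

section
/- Every special subgroup Γ ≤ Homeo₊(I) is metabelian (solvable of degree at most 2). -/
open Set

namespace HeightHomeo

/-- The group of orientation-preserving homeomorphisms of a linearly ordered space,
modeled as order-automorphisms (for `I = [0,1]` these are exactly the
orientation-preserving homeomorphisms). -/
instance ordIsoGroup {α : Type*} [Preorder α] : Group (α ≃o α) where
  mul f g := g.trans f
  one := OrderIso.refl α
  inv := OrderIso.symm
  mul_assoc _ _ _ := rfl
  one_mul _ := rfl
  mul_one _ := rfl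
  inv_mul_cancel f := by ext x; exact f.symm_apply_apply x

/-- `Homeo₊(I)`: the group of orientation-preserving homeomorphisms of the closed
unit interval `I = [0,1]`. -/
abbrev HomeoI := unitInterval ≃o unitInterval

/-- The order-convex hull of a set of points of the unit interval. -/
def ordHull (S : Set unitInterval) : Set unitInterval :=
  {y | ∃ a ∈ S, ∃ b ∈ S, a ≤ y ∧ y ≤ b}

/-- `A` is an orbital of the homeomorphism `g`: the convex hull of the orbit of some
point of `I` under the cyclic subgroup `⟨g⟩`, provided it contains more than one point. -/
def IsOrbitalOf (g : HomeoI) (A : Set unitInterval) : Prop :=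
  ∃ x : unitInterval,
    A = ordHull (Set.range fun n : ℤ => (g ^ n) x) ∧ A.Nontrivial

/-- A tower of a subgroup `Γ ≤ Homeo₊(I)`: a set `T` of signed orbitals `(A, g)`
(with `g ∈ Γ` and `A` an orbital of `g`) whose orbitals form a chain under inclusion,
and containing exactly one signed orbital for each of the occurring orbitals. -/
def IsTower (Γ : Subgroup HomeoI) (T : Set (Set unitInterval × HomeoI)) : Prop :=
  (∀ p ∈ T, p.2 ∈ Γ ∧ IsOrbitalOf p.2 p.1) ∧
  (∀ p ∈ T, ∀ q ∈ T, p.1 ⊆ q.1 ∨ q.1 ⊆ p.1) ∧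
  (∀ p ∈ T, ∀ q ∈ T, p.1 = q.1 → p = q)

/-- The left endpoint of a set of points of the unit interval, as a real number. -/
noncomputable def leftEnd (A : Set unitInterval) : ℝ :=
  sInf ((fun x : unitInterval => (x : ℝ)) '' A)

/-- The right endpoint of a set of points of the unit interval, as a real number. -/
noncomputable def rightEnd (A : Set unitInterval) : ℝ :=
  sSup ((fun x : unitInterval => (x : ℝ)) '' A)

/-- Two intervals share an end if they have a common left endpoint or a common right
endpoint. -/
def ShareEnd (A B : Set unitInterval) : Prop :=
  leftEnd A = leftEnd B ∨ rightEnd A = rightEnd B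

/-- A tower is strict if no two distinct orbitals occurring in it share an end. -/
def IsStrictTower (Γ : Subgroup HomeoI) (T : Set (Set unitInterval × HomeoI)) : Prop :=
  IsTower Γ T ∧ ∀ p ∈ T, ∀ q ∈ T, p.1 ≠ q.1 → ¬ ShareEnd p.1 q.1

/-- The set of orbitals occurring in a tower. -/
def towerOrbitals (T : Set (Set unitInterval × HomeoI)) : Set (Set unitInterval) :=
  Prod.fst '' T

/-- The height `h(Γ)` of a subgroup of `Homeo₊(I)`: the supremum (in `ℕ∞`) of the
cardinalities of the sets of orbitals of its towers. -/
noncomputable def height (Γ : Subgroup HomeoI) : ℕ∞ :=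
  ⨆ T ∈ {T | IsTower Γ T}, (towerOrbitals T).encard

/-- The strict height `h_strict(Γ)` of a subgroup of `Homeo₊(I)`: the supremum (in
`ℕ∞`) of the cardinalities of the sets of orbitals of its strict towers. -/
noncomputable def strictHeight (Γ : Subgroup HomeoI) : ℕ∞ :=
  ⨆ T ∈ {T | IsStrictTower Γ T}, (towerOrbitals T).encard

/-- An interval in `I` is inner if it does not share an end with `(0,1)`. -/
def IsInner (A : Set unitInterval) : Prop :=
  leftEnd A ≠ 0 ∧ rightEnd A ≠ 1

/-- A homeomorphism `f` is special if the cyclic subgroup `⟨f⟩` possesses no inner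
orbital. -/
def Special (f : HomeoI) : Prop :=
  ∀ A, IsOrbitalOf f A → ¬ IsInner A

open scoped commutatorElement

/-- In a totally preordered group with bi-invariant preorder, every element bounded on both sides
by powers of some `c > 1` lies between two consecutive powers of `c`. -/
theorem exists_zpow_le_lt {G : Type*} [Group G] [Preorder G] [MulLeftMono G] [MulRightMono G]
    (htot : ∀ a b : G, a ≤ b ∨ b ≤ a) {c g : G} (hc : ¬ c ≤ 1)
    (hub : ∃ j : ℕ, g ≤ c ^ j) (hlb : ∃ j : ℕ, g⁻¹ ≤ c ^ j) :
    ∃ m : ℤ, c ^ m ≤ g ∧ ¬ c ^ (m + 1) ≤ g := by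
  have h1c : 1 ≤ c := (htot 1 c).resolve_right hc
  obtain ⟨i, hi⟩ := hub
  obtain ⟨j, hj⟩ := hlb
  obtain ⟨m, hm, hmax⟩ := Int.exists_greatest_of_bdd (P := fun m : ℤ => c ^ m ≤ g)
    ⟨i, fun m hm => by
      by_contra! hlt
      obtain ⟨k, rfl⟩ := Int.exists_add_of_le (Int.add_one_le_of_lt hlt)
      have h : c ^ (i : ℤ) * (c * c ^ k) ≤ c ^ (i : ℤ) * 1 := by
        rw [mul_one, ← mul_assoc, ← zpow_add_one, ← zpow_natCast c k, ← zpow_add, zpow_natCast]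
        exact hm.trans hi
      have h' : c * c ^ k ≤ 1 := le_of_mul_le_mul_left' h
      exact hc ((le_mul_of_one_le_right' (one_le_pow_of_one_le' h1c k)).trans
        (by simpa using h'))⟩
    ⟨-j, by
      rw [zpow_neg, zpow_natCast]
      exact inv_le_of_inv_le' hj⟩
  exact ⟨m, hm, fun h => by have := hmax _ h; omega⟩

/-- A commutator `c = ⁅x, y⁆ > 1` of a bi-preordered group cannot have powers dominating
`x ^ 2`, `y ^ 2` and their inverses. -/
theorem commutator_powers_not_dominating {G : Type*} [Group G] [Preorder G] [MulLeftMono G]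
    [MulRightMono G] (htot : ∀ a b : G, a ≤ b ∨ b ≤ a) {x y : G} (hc : ¬ ⁅x, y⁆ ≤ 1)
    (hx : ∃ j : ℕ, x * x ≤ ⁅x, y⁆ ^ j) (hx' : ∃ j : ℕ, (x * x)⁻¹ ≤ ⁅x, y⁆ ^ j)
    (hy : ∃ j : ℕ, y * y ≤ ⁅x, y⁆ ^ j) (hy' : ∃ j : ℕ, (y * y)⁻¹ ≤ ⁅x, y⁆ ^ j) : False := by
  obtain ⟨m, hm, hm'⟩ := exists_zpow_le_lt htot hc hx hx'
  obtain ⟨n, hn, hn'⟩ := exists_zpow_le_lt htot hc hy hy'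
  have hxy : x * y = ⁅x, y⁆ * (y * x) := by simp [commutatorElement_def, mul_assoc]
  generalize ⁅x, y⁆ = c at *
  have h1c : 1 ≤ c := (htot 1 c).resolve_right hc
  have hle : y * x ≤ x * y := by
    rw [hxy]; exact le_mul_of_one_le_left' h1c
  have hupper : (x * y) * (x * y) ≤ (x * x) * (y * y) := by
    calc (x * y) * (x * y) = x * (y * x) * y := by group
      _ ≤ x * (x * y) * y := by gcongr
      _ = _ := by group
  have hlower : c ^ m * c ^ n ≤ (y * x) * (y * x) := by
    calc c ^ m * c ^ n = c ^ n * c ^ m := by rw [← zpow_add, ← zpow_add, add_comm]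
      _ ≤ (y * y) * (x * x) := by gcongr
      _ = y * (y * x) * x := by group
      _ ≤ y * (x * y) * x := by gcongr
      _ = _ := by group
  have hsquare : c ^ (m + n + 2) ≤ (x * y) * (x * y) := by
    rw [hxy]
    generalize y * x = u at *
    rcases htot (c * u) (u * c) with h | h
    · calc c ^ (m + n + 2) = c * c * (c ^ m * c ^ n) := by
            rw [← zpow_add, ← zpow_two, ← zpow_add]; congr 1; ring
        _ ≤ c * c * (u * u) := by gcongr
        _ = c * (c * u) * u := by group
        _ ≤ c * (u * c) * u := by gcongr
        _ = _ := by group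
    · calc c ^ (m + n + 2) = (c ^ m * c ^ n) * (c * c) := by
            rw [← zpow_add, ← zpow_two, ← zpow_add]
        _ ≤ (u * u) * (c * c) := by gcongr
        _ = u * (u * c) * c := by group
        _ ≤ u * (c * u) * c := by gcongr
        _ = (u * c) * (u * c) := by group
        _ ≤ _ := by gcongr
  have hyn : y * y ≤ c ^ (n + 1) := (htot _ _).resolve_right hn'
  refine hm' ?_
  have h := (hsquare.trans hupper).trans (mul_le_mul_right hyn (x * x))
  have h2 : c ^ (m + n + 2) = c ^ (m + 1) * c ^ (n + 1) := by
    rw [← zpow_add]; congr 1; ring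
  rw [h2] at h
  exact le_of_mul_le_mul_right' h

/-- The fixed points of `f` in the open interval `(0,1)` form an order-convex set. -/
def InteriorFixConvex (f : HomeoI) : Prop :=
  ∀ ⦃p r q : unitInterval⦄, 0 < p → p ≤ r → r ≤ q → q < 1 → f p = p → f q = q → f r = r

theorem mul_apply (f g : HomeoI) (x : unitInterval) : (f * g) x = f (g x) := rfl

theorem one_apply (x : unitInterval) : (1 : HomeoI) x = x := rfl

theorem inv_apply_self (f : HomeoI) (x : unitInterval) : f⁻¹ (f x) = x := f.symm_apply_apply x

theorem apply_inv_self (f : HomeoI) (x : unitInterval) : f (f⁻¹ x) = x := f.apply_symm_apply x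

theorem zpow_apply_mem_Ioo {f : HomeoI} {p r q : unitInterval} (hp : f p = p) (hq : f q = q)
    (hpr : p < r) (hrq : r < q) (n : ℤ) : p < (f ^ n) r ∧ (f ^ n) r < q := by
  have hfix : ∀ {z : unitInterval}, f z = z → (f ^ n) z = z := by
    intro z hz
    have hmem : f ∈ ({ carrier := {g : HomeoI | g z = z}
                       mul_mem' := fun {a b} ha hb => by
                        simp only [mem_ofPred_eq] at *
                        rw [mul_apply, hb, ha]
                       one_mem' := rfl
                       inv_mem' := fun {a} ha => by
                        simp only [mem_ofPred_eq] at *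
                        conv_lhs => rw [← ha]
                        exact inv_apply_self a z } : Subgroup HomeoI) := hz
    exact Subgroup.zpow_mem _ hmem n
  constructor
  · conv_lhs => rw [← hfix hp]
    exact (f ^ n).strictMono hpr
  · conv_rhs => rw [← hfix hq]
    exact (f ^ n).strictMono hrq

theorem Special.interiorFixConvex {f : HomeoI} (hf : Special f) : InteriorFixConvex f := by
  intro p r q hp hpr hrq hq hfp hfq
  by_contra hr
  have hpr : p < r := lt_of_le_of_ne hpr (by rintro rfl; exact hr hfp)
  have hrq : r < q := lt_of_le_of_ne hrq (by rintro rfl; exact hr hfq)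
  have horb := zpow_apply_mem_Ioo hfp hfq hpr hrq
  have hsub : ∀ z ∈ ordHull (range fun n : ℤ => (f ^ n) r), p ≤ z ∧ z ≤ q := by
    rintro z ⟨_, ⟨m, rfl⟩, _, ⟨n, rfl⟩, h1, h2⟩
    exact ⟨(horb m).1.le.trans h1, h2.trans (horb n).2.le⟩
  have hmem0 : r ∈ ordHull (range fun n : ℤ => (f ^ n) r) :=
    ⟨r, ⟨0, rfl⟩, r, ⟨0, rfl⟩, le_rfl, le_rfl⟩
  have hmem1 : f r ∈ ordHull (range fun n : ℤ => (f ^ n) r) :=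
    ⟨f r, ⟨1, by simp⟩, f r, ⟨1, by simp⟩, le_rfl, le_rfl⟩
  refine hf _ ⟨r, rfl, ⟨r, hmem0, f r, hmem1, Ne.symm hr⟩⟩ ⟨?_, ?_⟩
  · have hle : (p : ℝ) ≤ leftEnd (ordHull (range fun n : ℤ => (f ^ n) r)) := by
      refine le_csInf ⟨_, mem_image_of_mem _ hmem0⟩ ?_
      rintro _ ⟨z, hz, rfl⟩
      exact (hsub z hz).1
    exact (lt_of_lt_of_le (show (0 : ℝ) < p from hp) hle).ne'
  · have hle : rightEnd (ordHull (range fun n : ℤ => (f ^ n) r)) ≤ (q : ℝ) := by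
      refine csSup_le ⟨_, mem_image_of_mem _ hmem0⟩ ?_
      rintro _ ⟨z, hz, rfl⟩
      exact (hsub z hz).2
    exact (lt_of_le_of_lt hle (show (q : ℝ) < 1 from hq)).ne

theorem exists_fixed_of_lt_of_gt (f : HomeoI) {x y : unitInterval} (hxy : x ≤ y)
    (hx : f x ≤ x) (hy : y ≤ f y) : ∃ z, x ≤ z ∧ z ≤ y ∧ f z = z := by
  obtain ⟨z, hz, h⟩ := isPreconnected_Icc.intermediate_value₂ (left_mem_Icc.2 hxy)
    (right_mem_Icc.2 hxy) f.continuous.continuousOn continuousOn_id hx hy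
  exact ⟨z, hz.1, hz.2, h⟩

theorem exists_fixed_of_gt_of_lt (f : HomeoI) {x y : unitInterval} (hxy : x ≤ y)
    (hx : x ≤ f x) (hy : f y ≤ y) : ∃ z, x ≤ z ∧ z ≤ y ∧ f z = z := by
  obtain ⟨z, hz, h⟩ := isPreconnected_Icc.intermediate_value₂ (left_mem_Icc.2 hxy)
    (right_mem_Icc.2 hxy) continuousOn_id f.continuous.continuousOn hx hy
  exact ⟨z, hz.1, hz.2, h.symm⟩

theorem exists_lt_pow_apply {f : HomeoI} {x y : unitInterval}
    (hf : ∀ z, x ≤ z → z < 1 → z < f z) (hy : y < 1) :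
    ∃ N : ℕ, ∀ j ≥ N, y < (f ^ j) x := by
  have hlub := isLUB_iSup (f := fun j : ℕ => (f ^ j) x)
  set s := ⨆ j : ℕ, (f ^ j) x
  have hxs : x ≤ s := hlub.1 ⟨0, rfl⟩
  have hs : s = 1 := by
    by_contra hne
    have h1 : f⁻¹ s < s := by
      have := f⁻¹.strictMono (hf s hxs (lt_of_le_of_ne s.2.2 hne))
      rwa [inv_apply_self] at this
    obtain ⟨_, ⟨j, rfl⟩, hj, -⟩ := hlub.exists_between h1
    have h2 := f.strictMono hj
    rw [apply_inv_self, ← mul_apply, ← pow_succ'] at h2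
    exact (hlub.1 ⟨j + 1, rfl⟩).not_gt h2
  rw [hs] at hlub
  obtain ⟨_, ⟨N, rfl⟩, hN, -⟩ := hlub.exists_between hy
  have hxj : ∀ j : ℕ, x ≤ (f ^ j) x ∧ (f ^ j) x ≤ (f ^ (j + 1)) x := by
    intro j
    have key : ∀ z, x ≤ z → z ≤ f z := fun z hz => by
      rcases eq_or_lt_of_le (show z ≤ 1 from z.2.2) with rfl | h
      · exact (f.map_top).ge
      · exact (hf z hz h).le
    induction j with
    | zero => exact ⟨le_rfl, by simpa [one_apply] using key x le_rfl⟩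
    | succ j ih =>
      have := ih.1.trans ih.2
      refine ⟨this, ?_⟩
      rw [pow_succ' f (j + 1), mul_apply]
      exact key _ this
  exact ⟨N, fun j hj => hN.trans_le (monotone_nat_of_le_succ (f := fun j => (f ^ j) x)
    (fun j => (hxj j).2) hj)⟩

/-- Conjugation by the flip `x ↦ 1 - x` of the unit interval. -/
def flip : HomeoI →* HomeoI where
  toFun f :=
    { toFun := fun x => unitInterval.symm (f (unitInterval.symm x))
      invFun := fun x => unitInterval.symm (f.symm (unitInterval.symm x))
      left_inv := fun x => by simp
      right_inv := fun x => by simp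
      map_rel_iff' := by
        intro a b
        simp [unitInterval.symm_le_symm] }
  map_one' := by ext x; simp [one_apply]
  map_mul' f g := by ext x; simp [mul_apply]

theorem flip_apply (f : HomeoI) (x : unitInterval) :
    flip f x = unitInterval.symm (f (unitInterval.symm x)) := rfl

theorem InteriorFixConvex.flip {f : HomeoI} (hf : InteriorFixConvex f) :
    InteriorFixConvex (flip f) := by
  intro p r q hp hpr hrq hq hfp hfq
  rw [flip_apply] at *
  have := hf (p := unitInterval.symm q) (r := unitInterval.symm r) (q := unitInterval.symm p)
    (by rwa [unitInterval.lt_symm_comm, unitInterval.symm_zero])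
    (unitInterval.symm_le_symm.2 hrq) (unitInterval.symm_le_symm.2 hpr)
    (by rwa [unitInterval.symm_lt_comm, unitInterval.symm_one])
    (by conv_rhs => rw [← hfq, unitInterval.symm_symm])
    (by conv_rhs => rw [← hfp, unitInterval.symm_symm])
  rw [this, unitInterval.symm_symm]

theorem exists_pow_apply_lt {f : HomeoI} {x y : unitInterval}
    (hf : ∀ z, 0 < z → z ≤ x → f z < z) (hy : 0 < y) :
    ∃ N : ℕ, ∀ j ≥ N, (f ^ j) x < y := by
  obtain ⟨N, hN⟩ := exists_lt_pow_apply (f := flip f) (x := unitInterval.symm x)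
    (y := unitInterval.symm y)
    (fun z hz hz1 => by
      rw [flip_apply, unitInterval.lt_symm_comm]
      refine hf _ ?_ (unitInterval.symm_le_comm.1 hz)
      rwa [unitInterval.lt_symm_comm, unitInterval.symm_zero])
    (by rwa [unitInterval.symm_lt_comm, unitInterval.symm_one])
  refine ⟨N, fun j hj => ?_⟩
  have := hN j hj
  rw [← map_pow, flip_apply, unitInterval.symm_symm] at this
  exact unitInterval.symm_lt_symm.1 this

theorem InteriorFixConvex.lt_apply_of_expanding {f : HomeoI} (hf : InteriorFixConvex f)
    {x y z : unitInterval} (hx : 0 < x) (hxy : x ≤ y) (hfx : f x ≤ x) (hfy : y < f y)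
    (hyz : y ≤ z) (hz : z < 1) : z < f z := by
  by_contra! h
  obtain ⟨v, hxv, hvy, hv⟩ := exists_fixed_of_lt_of_gt f hxy hfx hfy.le
  obtain ⟨w, hyw, hwz, hw⟩ := exists_fixed_of_gt_of_lt f hyz hfy.le h
  exact hfy.ne' (hf (hx.trans_le hxv) hvy hyw (hwz.trans_lt hz) hv hw)

theorem InteriorFixConvex.apply_lt_of_expanding {f : HomeoI} (hf : InteriorFixConvex f)
    {x y z : unitInterval} (hy : y < 1) (hxy : x ≤ y) (hfx : f x < x) (hfy : y ≤ f y)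
    (hzx : z ≤ x) (hz : 0 < z) : f z < z := by
  by_contra! h
  obtain ⟨v, hxv, hvy, hv⟩ := exists_fixed_of_lt_of_gt f hxy hfx.le hfy
  obtain ⟨w, hzw, hwx, hw⟩ := exists_fixed_of_gt_of_lt f hzx h hfx.le
  exact hfx.ne (hf (hz.trans_le hzw) hwx hxv (hvy.trans_lt hy) hw hv)

/-- The preorder on a group acting on the interval which compares germs at `1`. -/
abbrev germPreorder {G : Type*} [Group G] (ρ : G →* HomeoI) : Preorder G where
  le f g := ∃ a < 1, ∀ x, a < x → ρ f x ≤ ρ g x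
  le_refl f := ⟨0, zero_lt_one, fun _ _ => le_rfl⟩
  le_trans f g h := by
    rintro ⟨a, ha, hfg⟩ ⟨b, hb, hgh⟩
    exact ⟨max a b, max_lt ha hb, fun x hx =>
      (hfg x ((le_max_left a b).trans_lt hx)).trans (hgh x ((le_max_right a b).trans_lt hx))⟩

section Germ

variable {G : Type*} [Group G] (ρ : G →* HomeoI)

theorem germPreorder_le_iff {f g : G} :
    (germPreorder ρ).le f g ↔ ∃ a < 1, ∀ x, a < x → ρ f x ≤ ρ g x := Iff.rfl

theorem germPreorder_mulLeftMono : letI := germPreorder ρ; MulLeftMono G := by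
  let _ := germPreorder ρ
  refine ⟨fun k f g => ?_⟩
  rintro ⟨a, ha, h⟩
  refine ⟨a, ha, fun x hx => ?_⟩
  simp only [map_mul, mul_apply]
  exact (ρ k).monotone (h x hx)

theorem germPreorder_mulRightMono : letI := germPreorder ρ; MulRightMono G := by
  let _ := germPreorder ρ
  refine ⟨fun k f g => ?_⟩
  rintro ⟨a, ha, h⟩
  have hlt : (ρ k)⁻¹ a < 1 := by
    have := (ρ k)⁻¹.strictMono ha
    rwa [show (ρ k)⁻¹ 1 = 1 from (ρ k)⁻¹.map_top] at this
  refine ⟨(ρ k)⁻¹ a, hlt, fun x hx => ?_⟩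
  simp only [Function.swap, map_mul, mul_apply]
  refine h _ ?_
  have := (ρ k).strictMono hx
  rwa [apply_inv_self] at this

variable {ρ} (hρ : ∀ g, InteriorFixConvex (ρ g))

theorem germPreorder_one_total (g : G) (hg : InteriorFixConvex (ρ g)) :
    (germPreorder ρ).le 1 g ∨ (germPreorder ρ).le g 1 := by
  by_contra! h
  simp only [germPreorder_le_iff, map_one, one_apply] at h
  push Not at h
  obtain ⟨h1, h2⟩ := h
  obtain ⟨x, hx0, hx⟩ := h1 0 zero_lt_one
  have hx1 : x < 1 := lt_of_le_of_ne x.2.2 (by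
    rintro rfl
    exact hx.ne (ρ g).map_top)
  obtain ⟨y, hxy, hy⟩ := h2 x hx1
  have hy1 : y < 1 := lt_of_le_of_ne y.2.2 (by
    rintro rfl
    exact hy.ne' (ρ g).map_top)
  obtain ⟨z, hyz, hz⟩ := h1 y hy1
  have hz1 : z < 1 := lt_of_le_of_ne z.2.2 (by
    rintro rfl
    exact hz.ne (ρ g).map_top)
  exact hz.not_gt (hg.lt_apply_of_expanding hx0 hxy.le hx.le hy hyz.le hz1)

include hρ

theorem germPreorder_total (f g : G) :
    (germPreorder ρ).le f g ∨ (germPreorder ρ).le g f := by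
  let _ := germPreorder ρ
  have := germPreorder_mulLeftMono ρ
  rcases germPreorder_one_total (f⁻¹ * g) (hρ _) with h | h
  · exact Or.inl (by simpa using mul_le_mul_right h f)
  · exact Or.inr (by simpa using mul_le_mul_right h f)

theorem expanding_one_lt {e : G} {x y : unitInterval} (hx : 0 < x) (hxy : x ≤ y) (hy : y < 1)
    (hex : ρ e x < x) (hey : y < ρ e y) : ¬ (germPreorder ρ).le e 1 := by
  rintro ⟨a, ha, h⟩
  obtain ⟨z, hz, hz1⟩ := exists_between (max_lt ha hy)
  have := (hρ e).lt_apply_of_expanding hx hxy hex.le hey ((le_max_right a y).trans hz.le) hz1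
  exact (h z ((le_max_left a y).trans_lt hz)).not_gt (by simpa [one_apply] using this)

theorem expanding_cofinal {e : G} {x y : unitInterval} (hx : 0 < x) (hxy : x ≤ y) (hy : y < 1)
    (hex : ρ e x < x) (hey : y < ρ e y) (g : G) : ∃ j : ℕ, (germPreorder ρ).le g (e ^ j) := by
  have hgx : 0 < ρ g x := by
    have := (ρ g).strictMono hx
    rwa [show (ρ g) 0 = 0 from (ρ g).map_bot] at this
  have hgy : ρ g y < 1 := by
    have := (ρ g).strictMono hy
    rwa [show (ρ g) 1 = 1 from (ρ g).map_top] at this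
  obtain ⟨M, hM⟩ := exists_pow_apply_lt (f := ρ e) (x := x)
    (fun z hz hzx => (hρ e).apply_lt_of_expanding hy hxy hex hey.le hzx hz) hgx
  obtain ⟨N, hN⟩ := exists_lt_pow_apply (f := ρ e) (x := y)
    (fun z hyz hz => (hρ e).lt_apply_of_expanding hx hxy hex.le hey hyz hz) hgy
  have h1 := hM (max M N) (le_max_left _ _)
  have h2 := hN (max M N) (le_max_right _ _)
  refine ⟨max M N, (germPreorder_total hρ _ _).resolve_right ?_⟩
  let _ := germPreorder ρ
  have := germPreorder_mulLeftMono ρ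
  intro h
  refine expanding_one_lt hρ (e := g⁻¹ * e ^ max M N) hx hxy hy ?_ ?_ ?_
  · have := (ρ g)⁻¹.strictMono h1
    rwa [inv_apply_self, ← map_inv, ← map_pow, ← mul_apply, ← map_mul] at this
  · have := (ρ g)⁻¹.strictMono h2
    rwa [inv_apply_self, ← map_inv, ← map_pow, ← mul_apply, ← map_mul] at this
  · simpa using mul_le_mul_right h g⁻¹

/-- An element pushing all points near `1` upwards dominates, up to taking powers, the square of
every commutator. -/
theorem commutator_sq_le_pow {d : G} {x₀ : unitInterval} (hx₀ : 0 < x₀) (hx₁ : x₀ < 1)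
    (hd : ∀ z, x₀ ≤ z → z < 1 → z < ρ d z) (x y : G) :
    ∃ j : ℕ, (germPreorder ρ).le (⁅x, y⁆ * ⁅x, y⁆) (d ^ j) := by
  let _ := germPreorder ρ
  have := germPreorder_mulLeftMono ρ
  have := germPreorder_mulRightMono ρ
  have htot : ∀ a b : G, a ≤ b ∨ b ≤ a := germPreorder_total hρ
  set c := ⁅x, y⁆
  have hcx : ρ (c * c) x₀ < 1 := by
    have := (ρ (c * c)).strictMono hx₁
    rwa [show (ρ (c * c)) 1 = 1 from (ρ (c * c)).map_top] at this
  obtain ⟨j, hj⟩ := exists_lt_pow_apply hd hcx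
  refine ⟨j, ?_⟩
  by_contra hnle
  rw [germPreorder_le_iff] at hnle
  push Not at hnle
  obtain ⟨y₀, hxy, hy⟩ := hnle x₀ hx₁
  have hy1 : y₀ < 1 := lt_of_le_of_ne y₀.2.2 (by
    rintro rfl
    exact hy.ne ((ρ _).map_top.trans (ρ _).map_top.symm))
  have hex : ρ ((d ^ j)⁻¹ * (c * c)) x₀ < x₀ := by
    have hj' : ρ (c * c) x₀ < ρ (d ^ j) x₀ := by
      rw [map_pow]
      exact hj j le_rfl
    have := (ρ (d ^ j))⁻¹.strictMono hj'
    rwa [inv_apply_self, ← map_inv, ← mul_apply, ← map_mul] at this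
  have hey : y₀ < ρ ((d ^ j)⁻¹ * (c * c)) y₀ := by
    have := (ρ (d ^ j))⁻¹.strictMono hy
    rwa [inv_apply_self, ← map_inv, ← mul_apply, ← map_mul] at this
  have h1d : 1 ≤ d := ⟨x₀, hx₁, fun z hz => by
    rcases eq_or_lt_of_le (show z ≤ 1 from z.2.2) with rfl | h
    · exact ((ρ 1).map_top.trans (ρ d).map_top.symm).le
    · simpa [one_apply] using (hd z hz.le h).le⟩
  have hec : (d ^ j)⁻¹ * (c * c) ≤ c * c :=
    mul_le_of_le_one_left' (inv_le_one'.2 (one_le_pow_of_one_le' h1d j))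
  have he1 := expanding_one_lt hρ hx₀ hxy.le hy1 hex hey
  have h1c : ¬ c ≤ 1 := fun h => he1 (hec.trans (mul_le_one' h h))
  have hcof : ∀ g : G, ∃ i : ℕ, g ≤ c ^ i := by
    intro g
    obtain ⟨i, hi⟩ := expanding_cofinal hρ hx₀ hxy.le hy1 hex hey g
    refine ⟨2 * i, hi.trans ?_⟩
    rw [pow_mul, pow_two]
    exact pow_le_pow_left' hec i
  exact commutator_powers_not_dominating htot h1c (hcof _) (hcof _) (hcof _) (hcof _)

theorem not_lt_apply_commutator_commutator (x y u v : G) {x₀ : unitInterval} (hx₀ : 0 < x₀)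
    (hx₁ : x₀ < 1) :
    ¬ ∀ z, x₀ ≤ z → z < 1 → z < ρ ⁅⁅x, y⁆, ⁅u, v⁆⁆ z := by
  intro hd
  let _ := germPreorder ρ
  have := germPreorder_mulLeftMono ρ
  have := germPreorder_mulRightMono ρ
  have hsq := commutator_sq_le_pow hρ hx₀ hx₁ hd
  refine commutator_powers_not_dominating (germPreorder_total hρ) (x := ⁅x, y⁆) (y := ⁅u, v⁆)
    ?_ (hsq x y) ?_ (hsq u v) ?_
  · rintro ⟨a, ha, h⟩
    obtain ⟨z, hz, hz1⟩ := exists_between (max_lt ha hx₁)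
    have := hd z ((le_max_right a x₀).trans hz.le) hz1
    exact (h z ((le_max_left a x₀).trans_lt hz)).not_gt (by simpa [one_apply] using this)
  · rw [mul_inv_rev, commutatorElement_inv]
    exact hsq y x
  · rw [mul_inv_rev, commutatorElement_inv]
    exact hsq v u

theorem commutator_commutator_apply_le (x y u v : G) (x₀ : unitInterval) :
    ρ ⁅⁅x, y⁆, ⁅u, v⁆⁆ x₀ ≤ x₀ := by
  by_contra! h
  set d := ⁅⁅x, y⁆, ⁅u, v⁆⁆ with hd
  have hx₀ : 0 < x₀ := lt_of_le_of_ne x₀.2.1 (by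
    rintro rfl
    exact h.ne' (ρ d).map_bot)
  have hx₁ : x₀ < 1 := lt_of_le_of_ne x₀.2.2 (by
    rintro rfl
    exact h.ne' (ρ d).map_top)
  by_cases hright : ∀ z, x₀ ≤ z → z < 1 → z < ρ d z
  · exact not_lt_apply_commutator_commutator hρ x y u v hx₀ hx₁ hright
  push Not at hright
  obtain ⟨z, hxz, hz1, hz⟩ := hright
  obtain ⟨q, hxq, hqz, hq⟩ := exists_fixed_of_gt_of_lt (ρ d) hxz h.le hz
  have hleft : ∀ w, 0 < w → w ≤ x₀ → w < ρ d w := by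
    intro w hw hwx
    by_contra! hdw
    obtain ⟨p, hwp, hpx, hp⟩ := exists_fixed_of_lt_of_gt (ρ d) hwx hdw h.le
    exact h.ne' (hρ d (hw.trans_le hwp) hpx hxq (hqz.trans_lt hz1) hp hq)
  refine not_lt_apply_commutator_commutator (ρ := flip.comp ρ) (fun g => (hρ g).flip) u v x y
    (x₀ := unitInterval.symm x₀) (by rwa [unitInterval.lt_symm_comm, unitInterval.symm_zero])
    (by rwa [unitInterval.symm_lt_comm, unitInterval.symm_one]) fun w hw hw1 => ?_
  rw [← commutatorElement_inv, ← hd, MonoidHom.comp_apply, flip_apply, unitInterval.lt_symm_comm,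
    map_inv]
  have := hleft (unitInterval.symm w)
    (by rwa [unitInterval.lt_symm_comm, unitInterval.symm_zero]) (unitInterval.symm_le_comm.1 hw)
  have := (ρ d)⁻¹.strictMono this
  rwa [inv_apply_self] at this

theorem commutator_commutator_mem_ker (x y u v : G) : ρ ⁅⁅x, y⁆, ⁅u, v⁆⁆ = 1 := by
  refine DFunLike.ext _ _ fun z => ?_
  refine le_antisymm (commutator_commutator_apply_le hρ x y u v z) ?_
  have h := (ρ ⁅⁅x, y⁆, ⁅u, v⁆⁆).monotone (commutator_commutator_apply_le hρ u v x y z)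
  rwa [← mul_apply, ← map_mul, ← commutatorElement_inv ⁅x, y⁆, mul_inv_cancel, map_one] at h

end Germ

/-- Every special subgroup of `Homeo₊(I)` is metabelian. -/
theorem special_metabelian (Γ : Subgroup HomeoI)
    (hsp : ∀ f ∈ Γ, Special f) :
    derivedSeries ↥Γ 2 = ⊥ := by
  rw [derivedSeries_succ, derivedSeries_one, commutator_eq_closure,
    Subgroup.commutator_eq_bot_iff_le_centralizer, Subgroup.centralizer_closure,
    Subgroup.closure_le]
  rintro _ ⟨x, y, rfl⟩
  refine Subgroup.mem_centralizer_iff.2 ?_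
  rintro _ ⟨u, v, rfl⟩
  rw [← commutatorElement_eq_one_iff_mul_comm]
  exact Subtype.ext (commutator_commutator_mem_ker (ρ := Γ.subtype)
    (fun g => (hsp g g.2).interiorFixConvex) u v x y)

end HeightHomeo
end

section
/- Every special subgroup Γ ≤ Homeo₊(I) with h(Γ) < ∞ is Abelian. -/
open Set

namespace HeightHomeo

section OrderIsoAction

variable {α : Type*}

theorem ordIso_mul_apply [Preorder α] (f g : α ≃o α) (x : α) : (f * g) x = f (g x) := rfl

theorem ordIso_inv_apply_self [Preorder α] (f : α ≃o α) (x : α) : f⁻¹ (f x) = x :=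
  f.symm_apply_apply x

theorem ordIso_apply_inv_self [Preorder α] (f : α ≃o α) (x : α) : f (f⁻¹ x) = x :=
  f.apply_symm_apply x

theorem ordIso_zpow_add_apply [Preorder α] (f : α ≃o α) (m n : ℤ) (x : α) :
    (f ^ (m + n)) x = (f ^ m) ((f ^ n) x) := by
  rw [zpow_add, ordIso_mul_apply]

theorem ordIso_zpow_add_one_apply [Preorder α] (f : α ≃o α) (n : ℤ) (x : α) :
    (f ^ (n + 1)) x = f ((f ^ n) x) := by
  rw [add_comm, zpow_add, zpow_one, ordIso_mul_apply]

theorem ordIso_zpow_add_one_apply' [Preorder α] (f : α ≃o α) (n : ℤ) (x : α) :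
    (f ^ (n + 1)) x = (f ^ n) (f x) := by
  rw [zpow_add, zpow_one, ordIso_mul_apply]

theorem ordIso_zpow_fixed [Preorder α] {f : α ≃o α} {x : α} (h : f x = x) (n : ℤ) :
    (f ^ n) x = x := by
  induction n with
  | zero => rfl
  | succ k ih => rw [ordIso_zpow_add_one_apply', h, ih]
  | pred k ih =>
    have := ordIso_zpow_add_one_apply' f (-(k : ℤ) - 1) x
    rw [h, sub_add_cancel, ih] at this
    exact this.symm

theorem ordIso_zpow_strictMono [Preorder α] {f : α ≃o α} {x : α} (h : x < f x) :
    StrictMono fun n : ℤ => (f ^ n) x := by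
  refine strictMono_int_of_lt_succ fun n => ?_
  rw [ordIso_zpow_add_one_apply']
  exact (f ^ n).lt_iff_lt.2 h

/-- A group of order automorphisms acting on an invariant set in such a way that every element
fixing no point of the set has cofinal and coinitial orbits, and every other element acts
trivially, acts through an Abelian group (Hölder). -/
theorem commute_on_of_orbits_unbounded [LinearOrder α] {Γ : Subgroup (α ≃o α)} {A : Set α}
    (hA : ∀ g ∈ Γ, ∀ y ∈ A, g y ∈ A)
    (hmove : ∀ g ∈ Γ, ∀ y ∈ A, g y ≠ y →
      ∀ z ∈ A, ∃ i j : ℤ, (g ^ i) y ≤ z ∧ z ≤ (g ^ j) y) :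
    ∀ a ∈ Γ, ∀ b ∈ Γ, ∀ x ∈ A, a (b x) = b (a x) := by
  have floor : ∀ g ∈ Γ, ∀ y ∈ A, y < g y → ∀ z ∈ A, ∃ n : ℤ,
      (g ^ n) y ≤ z ∧ z < (g ^ (n + 1)) y := by
    intro g hg y hy hlt z hz
    obtain ⟨i, j, hi, hj⟩ := hmove g hg y hy hlt.ne' z hz
    obtain ⟨n, hn, hmax⟩ := Int.exists_greatest_of_bdd (P := fun n : ℤ => (g ^ n) y ≤ z)
      ⟨j, fun k hk => (ordIso_zpow_strictMono hlt).le_iff_le.1 (hk.trans hj)⟩ ⟨i, hi⟩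
    refine ⟨n, hn, lt_of_not_ge fun h => ?_⟩
    have := hmax _ h
    omega
  have pos : ∀ g ∈ Γ, ∀ y ∈ A, y < g y → ∀ z ∈ A, z < g z := by
    intro g hg y hy hlt z hz
    obtain ⟨n, hn, hn'⟩ := floor g hg y hy hlt z hz
    rw [ordIso_zpow_add_one_apply] at hn'
    exact hn'.trans_le (g.le_iff_le.2 hn)
  have lt_on : ∀ g ∈ Γ, ∀ h ∈ Γ, ∀ y ∈ A, g y < h y → ∀ z ∈ A, g z < h z := by
    intro g hg h hh y hy hlt z hz
    have h1 : y < (g⁻¹ * h) y := by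
      rw [← g.lt_iff_lt, ordIso_mul_apply, ordIso_apply_inv_self]
      exact hlt
    have h2 := pos _ (Γ.mul_mem (Γ.inv_mem hg) hh) y hy h1 z hz
    rwa [← g.lt_iff_lt, ordIso_mul_apply, ordIso_apply_inv_self] at h2
  have le_on : ∀ g ∈ Γ, ∀ h ∈ Γ, ∀ y ∈ A, g y ≤ h y → ∀ z ∈ A, g z ≤ h z := by
    intro g hg h hh y hy hle z hz
    by_contra! hlt
    exact absurd (lt_on h hh g hg z hz hlt y hy) hle.not_gt
  have main : ∀ a ∈ Γ, ∀ b ∈ Γ, ∀ x ∈ A, ¬ b (a x) < a (b x) := by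
    intro a ha b hb x hx hlt
    by_cases hmin : ∃ z ∈ Γ, x < z x ∧ ∀ g ∈ Γ, x < g x → z x ≤ g x
    · obtain ⟨z, hz, hzx, hzmin⟩ := hmin
      have cyc : ∀ g ∈ Γ, ∃ n : ℤ, ∀ y ∈ A, g y = (z ^ n) y := by
        intro g hg
        obtain ⟨n, hn, hn'⟩ := floor z hz x hx hzx (g x) (hA g hg x hx)
        have hzn := Γ.zpow_mem hz n
        have heq : (z ^ n) x = g x := by
          refine hn.eq_of_not_lt fun hlt' => ?_
          have h1 : x < ((z ^ n)⁻¹ * g) x := by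
            rw [← (z ^ n).lt_iff_lt, ordIso_mul_apply, ordIso_apply_inv_self]
            exact hlt'
          have h2 := hzmin _ (Γ.mul_mem (Γ.inv_mem hzn) hg) h1
          rw [← (z ^ n).le_iff_le, ordIso_mul_apply, ordIso_apply_inv_self,
            ← ordIso_zpow_add_one_apply'] at h2
          exact hn'.not_ge h2
        exact ⟨n, fun y hy => le_antisymm (le_on _ hg _ hzn x hx heq.ge y hy)
          (le_on _ hzn _ hg x hx heq.le y hy)⟩
      obtain ⟨m, hm⟩ := cyc a ha
      obtain ⟨n, hn⟩ := cyc b hb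
      rw [hm _ (hA b hb x hx), hm _ hx, hn _ hx, hn _ (hA _ (Γ.zpow_mem hz m) x hx),
        ← ordIso_zpow_add_apply, ← ordIso_zpow_add_apply, add_comm] at hlt
      exact hlt.false
    · push Not at hmin
      set c := a * b * (b * a)⁻¹ with hc
      have hcΓ : c ∈ Γ := Γ.mul_mem (Γ.mul_mem ha hb) (Γ.inv_mem (Γ.mul_mem hb ha))
      have hbax : b (a x) ∈ A := hA b hb _ (hA a ha x hx)
      have hcba : c (b (a x)) = a (b x) := by
        have : c * (b * a) = a * b := by rw [hc]; group
        exact congrArg (fun f : α ≃o α => f x) this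
      have hcx : x < c x := pos c hcΓ _ hbax (by rwa [hcba]) x hx
      obtain ⟨z, hz, hzx, hzc⟩ : ∃ z ∈ Γ, x < z x ∧ z (z x) ≤ c x := by
        obtain ⟨g, hg, hgx, hgc⟩ := hmin c hcΓ hcx
        rcases le_or_gt (g (g x)) (c x) with h | h
        · exact ⟨g, hg, hgx, h⟩
        · have hhΓ := Γ.mul_mem (Γ.inv_mem hg) hcΓ
          have hgh : ∀ y, g ((g⁻¹ * c) y) = c y := fun y => by
            rw [ordIso_mul_apply, ordIso_apply_inv_self]
          refine ⟨g⁻¹ * c, hhΓ, ?_, ?_⟩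
          · rw [← g.lt_iff_lt, hgh]
            exact hgc
          · have h1 : (g⁻¹ * c) x < g x := by
              rw [← g.lt_iff_lt, hgh]
              exact h
            exact (lt_on _ hhΓ g hg x hx h1 _ (hA _ hhΓ x hx)).le.trans (hgh x).le
      obtain ⟨m, hm, hm'⟩ := floor z hz x hx hzx (a x) (hA a ha x hx)
      obtain ⟨n, hn, hn'⟩ := floor z hz x hx hzx (b x) (hA b hb x hx)
      have hzk : ∀ k : ℤ, z ^ k ∈ Γ := Γ.zpow_mem hz
      have upper : a (b x) < (z ^ (m + 1 + (n + 1))) x := by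
        rw [ordIso_zpow_add_apply]
        exact (lt_on a ha _ (hzk _) x hx hm' _ (hA b hb x hx)).trans
          ((z ^ (m + 1)).lt_iff_lt.2 hn')
      have lower : (z ^ (n + m)) x ≤ b (a x) := by
        rw [ordIso_zpow_add_apply]
        exact ((z ^ n).le_iff_le.2 hm).trans
          (le_on _ (hzk n) b hb x hx hn _ (hA a ha x hx))
      have step : z (z (b (a x))) ≤ a (b x) := by
        rw [← hcba]
        exact le_on (z * z) (Γ.mul_mem hz hz) c hcΓ x hx hzc _ hbax
      have : m + 1 + (n + 1) = n + m + 1 + 1 := by ring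
      rw [this, ordIso_zpow_add_one_apply, ordIso_zpow_add_one_apply] at upper
      exact upper.not_ge ((z.le_iff_le.2 (z.le_iff_le.2 lower)).trans step)
  intro a ha b hb x hx
  exact le_antisymm (not_lt.1 (main a ha b hb x hx)) (not_lt.1 (main b hb a ha x hx))

end OrderIsoAction

/-- The convex hull of the orbit of `x` under the cyclic group generated by `g`. -/
def orbitHull (g : HomeoI) (x : unitInterval) : Set unitInterval :=
  ordHull (Set.range fun n : ℤ => (g ^ n) x)

theorem mem_orbitHull {g : HomeoI} {x y : unitInterval} :
    y ∈ orbitHull g x ↔ ∃ i j : ℤ, (g ^ i) x ≤ y ∧ y ≤ (g ^ j) x := by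
  constructor
  · rintro ⟨_, ⟨i, rfl⟩, _, ⟨j, rfl⟩, h⟩
    exact ⟨i, j, h⟩
  · rintro ⟨i, j, h⟩
    exact ⟨_, ⟨i, rfl⟩, _, ⟨j, rfl⟩, h⟩

theorem zpow_mem_orbitHull (g : HomeoI) (x : unitInterval) (n : ℤ) :
    (g ^ n) x ∈ orbitHull g x :=
  mem_orbitHull.2 ⟨n, n, le_rfl, le_rfl⟩

theorem self_mem_orbitHull (g : HomeoI) (x : unitInterval) : x ∈ orbitHull g x :=
  zpow_mem_orbitHull g x 0

theorem orbitHull_symm {g : HomeoI} {x y : unitInterval} (h : y ∈ orbitHull g x) :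
    x ∈ orbitHull g y := by
  obtain ⟨i, j, hi, hj⟩ := mem_orbitHull.1 h
  refine mem_orbitHull.2 ⟨-j, -i, ?_, ?_⟩
  · rw [← (g ^ j).le_iff_le, ← ordIso_zpow_add_apply, add_neg_cancel]
    exact hj
  · rw [← (g ^ i).le_iff_le, ← ordIso_zpow_add_apply, add_neg_cancel]
    exact hi

theorem orbitHull_subset {g : HomeoI} {x : unitInterval} {A : Set unitInterval}
    (hA : A.OrdConnected) (h : ∀ n : ℤ, (g ^ n) x ∈ A) : orbitHull g x ⊆ A := by
  intro y hy
  obtain ⟨i, j, hi, hj⟩ := mem_orbitHull.1 hy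
  exact hA.out (h i) (h j) ⟨hi, hj⟩

theorem ordConnected_orbitHull (g : HomeoI) (x : unitInterval) :
    (orbitHull g x).OrdConnected := by
  refine ⟨fun y hy z hz w hw => ?_⟩
  obtain ⟨i, _, hi, _⟩ := mem_orbitHull.1 hy
  obtain ⟨_, j, _, hj⟩ := mem_orbitHull.1 hz
  exact mem_orbitHull.2 ⟨i, j, hi.trans hw.1, hw.2.trans hj⟩

theorem zpow_mem_orbitHull_of_mem {g : HomeoI} {x y : unitInterval} (h : y ∈ orbitHull g x)
    (n : ℤ) : (g ^ n) y ∈ orbitHull g x := by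
  obtain ⟨i, j, hi, hj⟩ := mem_orbitHull.1 h
  refine mem_orbitHull.2 ⟨n + i, n + j, ?_, ?_⟩ <;> rw [ordIso_zpow_add_apply]
  · exact (g ^ n).le_iff_le.2 hi
  · exact (g ^ n).le_iff_le.2 hj

theorem orbitHull_eq {g : HomeoI} {x y : unitInterval} (h : y ∈ orbitHull g x) :
    orbitHull g y = orbitHull g x :=
  (orbitHull_subset (ordConnected_orbitHull g x) (zpow_mem_orbitHull_of_mem h)).antisymm
    (orbitHull_subset (ordConnected_orbitHull g y)
      (zpow_mem_orbitHull_of_mem (orbitHull_symm h)))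

theorem isOrbitalOf_orbitHull {g : HomeoI} {x : unitInterval} (h : g x ≠ x) :
    IsOrbitalOf g (orbitHull g x) :=
  ⟨x, rfl, g x, by simpa using zpow_mem_orbitHull g x 1, x, self_mem_orbitHull g x, h⟩

namespace IsOrbitalOf

variable {g u : HomeoI} {A : Set unitInterval}

theorem eq_orbitHull (hA : IsOrbitalOf g A) {y : unitInterval} (hy : y ∈ A) :
    A = orbitHull g y := by
  obtain ⟨x, rfl, -⟩ := hA
  exact (orbitHull_eq hy).symm

theorem nonempty (hA : IsOrbitalOf g A) : A.Nonempty := by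
  obtain ⟨_, _, h⟩ := hA
  exact h.nonempty

theorem ordConnected (hA : IsOrbitalOf g A) : A.OrdConnected := by
  obtain ⟨x, rfl, -⟩ := hA
  exact ordConnected_orbitHull g x

theorem apply_ne (hA : IsOrbitalOf g A) {y : unitInterval} (hy : y ∈ A) : g y ≠ y := by
  intro h
  have heq := hA.eq_orbitHull hy
  obtain ⟨x, -, hnt⟩ := hA
  have hsub : orbitHull g y ⊆ {y} :=
    orbitHull_subset ordConnected_singleton fun n => ordIso_zpow_fixed h n
  exact hnt.not_subset_singleton (heq.le.trans hsub)

theorem pos_of_mem (hA : IsOrbitalOf g A) {y : unitInterval} (hy : y ∈ A) : 0 < y :=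
  bot_lt_iff_ne_bot.2 fun h => hA.apply_ne hy (by rw [h]; exact g.map_bot)

theorem lt_one_of_mem (hA : IsOrbitalOf g A) {y : unitInterval} (hy : y ∈ A) : y < 1 :=
  lt_top_iff_ne_top.2 fun h => hA.apply_ne hy (by rw [h]; exact g.map_top)

theorem image (hA : IsOrbitalOf u A) (g : HomeoI) : IsOrbitalOf (g * u * g⁻¹) (g '' A) := by
  obtain ⟨x, hAx, hnt⟩ := hA
  refine ⟨g x, ?_, hnt.image g.injective⟩
  have hconj : ∀ n : ℤ, ((g * u * g⁻¹) ^ n) (g x) = g ((u ^ n) x) := fun n => by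
    rw [conj_zpow, ordIso_mul_apply, ordIso_mul_apply, ordIso_inv_apply_self]
  change A = orbitHull u x at hAx
  change _ = orbitHull (g * u * g⁻¹) (g x)
  ext y
  rw [hAx, mem_orbitHull]
  simp only [hconj]
  constructor
  · rintro ⟨z, hz, rfl⟩
    simpa using mem_orbitHull.1 hz
  · rintro ⟨i, j, hi, hj⟩
    refine ⟨g⁻¹ y, mem_orbitHull.2 ⟨i, j, ?_, ?_⟩, ordIso_apply_inv_self g y⟩
    · rwa [← g.le_iff_le, ordIso_apply_inv_self]
    · rwa [← g.le_iff_le, ordIso_apply_inv_self]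

/-- An orbital which is not inner contains all interior points of `I` on one side of each of its
points. -/
theorem lower_or_upper_of_not_isInner (hA : IsOrbitalOf g A) (hin : ¬ IsInner A) :
    (∀ a ∈ A, ∀ b, 0 < b → b ≤ a → b ∈ A) ∨ (∀ a ∈ A, ∀ b, b < 1 → a ≤ b → b ∈ A) := by
  have hne : ((fun x : unitInterval => (x : ℝ)) '' A).Nonempty := hA.nonempty.image _
  rw [IsInner, not_and_or, not_not, not_not] at hin
  refine hin.imp (fun h a ha b hb hba => ?_) (fun h a ha b hb hab => ?_)
  · have hb' : leftEnd A < (b : ℝ) := by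
      rw [h]
      exact hb
    obtain ⟨_, ⟨c, hc, rfl⟩, hcb⟩ := exists_lt_of_csInf_lt hne hb'
    exact hA.ordConnected.out hc ha ⟨le_of_lt hcb, hba⟩
  · have hb' : (b : ℝ) < rightEnd A := by
      rw [h]
      exact hb
    obtain ⟨_, ⟨c, hc, rfl⟩, hcb⟩ := exists_lt_of_lt_csSup hne hb'
    exact hA.ordConnected.out ha hc ⟨hab, le_of_lt hcb⟩

/-- An orbital which is not inner is nested with all its images. -/
theorem image_subset_or_subset_image (hA : IsOrbitalOf u A) (hin : ¬ IsInner A) (g : HomeoI) :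
    g '' A ⊆ A ∨ A ⊆ g '' A := by
  rw [or_iff_not_imp_right, not_subset]
  rintro ⟨a, ha, hag⟩ _ ⟨y, hy, rfl⟩
  have hgy := hA.image g
  have mem_image : ∀ b, g⁻¹ b ∈ A → b ∈ g '' A := fun b hb =>
    ⟨_, hb, ordIso_apply_inv_self g b⟩
  rcases hA.lower_or_upper_of_not_isInner hin with h | h
  · refine h a ha _ (hgy.pos_of_mem (mem_image_of_mem g hy)) (le_of_not_ge fun hle => hag ?_)
    refine mem_image a (h y hy _ ?_ ?_)
    · rw [← g.lt_iff_lt, ordIso_apply_inv_self]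
      exact g.map_bot.trans_lt (hA.pos_of_mem ha)
    · rwa [← g.le_iff_le, ordIso_apply_inv_self]
  · refine h a ha _ (hgy.lt_one_of_mem (mem_image_of_mem g hy)) (le_of_not_ge fun hle => hag ?_)
    refine mem_image a (h y hy _ ?_ ?_)
    · rw [← g.lt_iff_lt, ordIso_apply_inv_self]
      exact (hA.lt_one_of_mem ha).trans_eq g.map_top.symm
    · rwa [← g.le_iff_le, ordIso_apply_inv_self]

/-- In a group of finite height no element maps an orbital strictly into itself. -/
theorem subset_image_of_height_ne_top {Γ : Subgroup HomeoI} (hh : height Γ ≠ ⊤)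
    (hA : IsOrbitalOf u A) (hu : u ∈ Γ) (hg : g ∈ Γ) (h : g '' A ⊆ A) : A ⊆ g '' A := by
  by_contra hnot
  have hanti : StrictAnti fun n : ℕ => ((g ^ n : HomeoI) : unitInterval → unitInterval) '' A := by
    refine strictAnti_nat_of_succ_lt fun n => ?_
    have hn : (g ^ (n + 1) : HomeoI) '' A = (g ^ n : HomeoI) '' (g '' A) := by
      rw [pow_succ, image_image]
      rfl
    change (g ^ (n + 1) : HomeoI) '' A ⊂ (g ^ n : HomeoI) '' A
    rw [hn]
    exact (g ^ n).injective.image_strictMono ⟨h, hnot⟩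
  set T : Set (Set unitInterval × HomeoI) :=
    range fun n : ℕ => ((g ^ n : HomeoI) '' A, g ^ n * u * (g ^ n)⁻¹) with hT
  have htower : IsTower Γ T := by
    refine ⟨?_, ?_, ?_⟩
    · rintro _ ⟨n, rfl⟩
      have hn := Γ.pow_mem hg n
      exact ⟨Γ.mul_mem (Γ.mul_mem hn hu) (Γ.inv_mem hn), hA.image _⟩
    · rintro _ ⟨n, rfl⟩ _ ⟨m, rfl⟩
      exact (le_total m n).imp (fun h => hanti.antitone h) (fun h => hanti.antitone h)
    · rintro _ ⟨n, rfl⟩ _ ⟨m, rfl⟩ heq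
      obtain rfl : n = m := hanti.injective heq
      rfl
  have hinf : (towerOrbitals T).Infinite := by
    rw [towerOrbitals, hT, ← range_comp]
    exact infinite_range_of_injective hanti.injective
  refine hh (top_le_iff.1 ?_)
  rw [← hinf.encard_eq]
  exact le_biSup (fun T => (towerOrbitals T).encard) htower

theorem image_eq {Γ : Subgroup HomeoI} (hsp : ∀ f ∈ Γ, Special f) (hh : height Γ ≠ ⊤)
    (hA : IsOrbitalOf u A) (hu : u ∈ Γ) (hg : g ∈ Γ) : g '' A = A := by
  rcases hA.image_subset_or_subset_image (hsp u hu A hA) g with h | h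
  · exact h.antisymm (hA.subset_image_of_height_ne_top hh hu hg h)
  · have hinv : (g⁻¹ : HomeoI) '' A ⊆ A := by
      rintro _ ⟨y, hy, rfl⟩
      obtain ⟨z, hz, rfl⟩ := h hy
      rwa [ordIso_inv_apply_self]
    refine Subset.antisymm ?_ h
    rintro _ ⟨y, hy, rfl⟩
    obtain ⟨z, hz, rfl⟩ := hA.subset_image_of_height_ne_top hh hu (Γ.inv_mem hg) hinv hy
    rwa [ordIso_apply_inv_self]

end IsOrbitalOf

/-- Every special subgroup of `Homeo₊(I)` of finite height is Abelian. -/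
theorem special_finite_height_abelian (Γ : Subgroup HomeoI)
    (hsp : ∀ f ∈ Γ, Special f) (hh : height Γ ≠ ⊤) :
    ∀ a ∈ Γ, ∀ b ∈ Γ, a * b = b * a := by
  intro a ha b hb
  by_contra hne
  obtain ⟨x, hx⟩ : ∃ x, a (b x) ≠ b (a x) := by
    by_contra! h
    exact hne (by ext x; exact congrArg _ (h x))
  set c := (b * a)⁻¹ * (a * b)
  have hc : c ∈ Γ := Γ.mul_mem (Γ.inv_mem (Γ.mul_mem hb ha)) (Γ.mul_mem ha hb)
  have hcx : c x ≠ x := fun h => hx <| by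
    have h' := congrArg (b * a) h
    rwa [← ordIso_mul_apply, mul_inv_cancel_left] at h'
  have hA := isOrbitalOf_orbitHull hcx
  have maps : ∀ u ∈ Γ, ∀ B, IsOrbitalOf u B → ∀ g ∈ Γ, ∀ y ∈ B, g y ∈ B :=
    fun u hu B hB g hg y hy => hB.image_eq hsp hh hu hg ▸ mem_image_of_mem g hy
  refine hx (commute_on_of_orbits_unbounded (maps c hc _ hA) (fun g hg y hy hgy z hz => ?_)
    a ha b hb x (self_mem_orbitHull c x))
  have hB := isOrbitalOf_orbitHull hgy
  rw [hA.eq_orbitHull hy] at hz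
  exact mem_orbitHull.1 (orbitHull_subset hB.ordConnected
    (fun n => maps g hg _ hB _ (Γ.zpow_mem hc n) y (self_mem_orbitHull g y)) hz)

end HeightHomeo
end

section
/- Let Γ ≤ Diff^ω₊(I) be an irreducible subgroup and let N be a nontrivial Abelian normal subgroup of Γ. Then N acts freely on (0,1): no non-identity element of N has a fixed point in (0,1). -/
open Set

namespace HeightHomeo

/-- `f ∈ Diff^ω₊(I)`: `f` extends to a real-analytic map on a neighborhood of `[0,1]`
(being an order-automorphism of `[0,1]`, `f` is automatically strictly increasing and
fixes `0` and `1`). -/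
def IsAnalytic (f : HomeoI) : Prop :=
  ∃ F : ℝ → ℝ, (∀ x ∈ Set.Icc (0 : ℝ) 1, AnalyticAt ℝ F x) ∧
    ∀ x : unitInterval, F x = (f x : ℝ)

/-- The fixed-point set of a non-identity analytic element is finite. -/
theorem IsAnalytic.finite_fixedPoints {f : HomeoI} (hf : IsAnalytic f) (h1 : f ≠ 1) :
    {x : unitInterval | f x = x}.Finite := by
  obtain ⟨F, hF, hFf⟩ := hf
  by_contra hinf
  have himg : ((fun x : unitInterval => (x : ℝ)) '' {x | f x = x}).Infinite :=
    Set.Infinite.image Subtype.val_injective.injOn hinf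
  have hsub : (fun x : unitInterval => (x : ℝ)) '' {x | f x = x} ⊆ Set.Icc (0 : ℝ) 1 := by
    rintro _ ⟨x, -, rfl⟩
    exact x.2
  obtain ⟨z, hz, hacc⟩ := himg.exists_accPt_of_subset_isCompact isCompact_Icc hsub
  have han : AnalyticOnNhd ℝ (fun x => F x - x) (Set.Icc (0 : ℝ) 1) :=
    fun x hx => (hF x hx).sub analyticAt_id
  have hzero : Set.EqOn (fun x => F x - x) 0 (Set.Icc (0 : ℝ) 1) := by
    refine han.eqOn_zero_of_preconnected_of_frequently_eq_zero isPreconnected_Icc hz ?_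
    refine (accPt_iff_frequently_nhdsNE.mp hacc).mono ?_
    rintro _ ⟨x, hx, rfl⟩
    simp only [Set.mem_ofPred_eq] at hx
    simp [hFf, hx]
  refine h1 (OrderIso.ext (funext fun x => Subtype.ext ?_))
  have hx := hzero x.2
  simp only [hFf, Pi.zero_apply, sub_eq_zero] at hx
  exact hx

/-- A group of order automorphisms preserving a nonempty finite set fixes its minimum. -/
theorem exists_fixed_of_finite_invariant (G : Subgroup HomeoI) {S : Set unitInterval}
    (hfin : S.Finite) (hne : S.Nonempty) (hinv : ∀ g ∈ G, ∀ x ∈ S, g x ∈ S) :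
    ∃ m ∈ S, ∀ g ∈ G, g m = m := by
  obtain ⟨m, hm⟩ := hfin.exists_minimal hne
  have hle : ∀ g ∈ G, m ≤ g m := fun g hg =>
    (le_total m (g m)).elim id (hm.2 (hinv g hg m hm.1))
  refine ⟨m, hm.1, fun g hg => le_antisymm ?_ (hle g hg)⟩
  have h := g.monotone (hle g⁻¹ (G.inv_mem hg))
  rwa [show g (g⁻¹ m) = m from g.apply_symm_apply m] at h

/-- Order automorphisms of the unit interval preserve its interior. -/
theorem apply_mem_interior (g : HomeoI) {x : unitInterval} (hx : 0 < x ∧ x < 1) :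
    0 < g x ∧ g x < 1 :=
  ⟨g.map_bot.symm.trans_lt (g.strictMono hx.1), (g.strictMono hx.2).trans_eq g.map_top⟩

/-- A nontrivial Abelian normal subgroup of an irreducible subgroup of `Diff^ω₊(I)`
acts freely on `(0,1)`. -/
theorem abelian_normal_acts_freely (Γ N : Subgroup HomeoI)
    (hω : ∀ f ∈ Γ, IsAnalytic f)
    (hirr : ∀ x : unitInterval, 0 < (x : ℝ) → (x : ℝ) < 1 → ∃ g ∈ Γ, g x ≠ x)
    (hNle : N ≤ Γ) (hNnt : N ≠ ⊥)
    (hNab : ∀ a ∈ N, ∀ b ∈ N, a * b = b * a)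
    (hNnorm : ∀ g ∈ Γ, ∀ n ∈ N, g * n * g⁻¹ ∈ N) :
    ∀ f ∈ N, f ≠ 1 → ∀ x : unitInterval, 0 < (x : ℝ) → (x : ℝ) < 1 → f x ≠ x := by
  intro f hf hf1 x hx0 hx1 hfx
  have hfin := (hω f (hNle hf)).finite_fixedPoints hf1
  obtain ⟨m, ⟨hm01, -⟩, hmfix⟩ := exists_fixed_of_finite_invariant N
    (S := {y | (0 < y ∧ y < 1) ∧ f y = y}) (hfin.subset fun y hy => hy.2)
    ⟨x, ⟨hx0, hx1⟩, hfx⟩ (fun g hg y hy => ⟨apply_mem_interior g hy.1, by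
      have h : f (g y) = g (f y) := DFunLike.congr_fun (hNab f hf g hg) y
      rw [h, hy.2]⟩)
  obtain ⟨p, ⟨hp01, -⟩, hpfix⟩ := exists_fixed_of_finite_invariant Γ
    (S := {y | (0 < y ∧ y < 1) ∧ ∀ n ∈ N, n y = y}) (hfin.subset fun y hy => hy.2 f hf)
    ⟨m, hm01, hmfix⟩ (fun g hg y hy => ⟨apply_mem_interior g hy.1, fun n hn => by
      have hc := hNnorm g⁻¹ (Γ.inv_mem hg) n hn
      rw [inv_inv] at hc
      have h : g (g⁻¹ (n (g y))) = g y := congrArg g (hy.2 _ hc)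
      rwa [show g (g⁻¹ (n (g y))) = n (g y) from g.apply_symm_apply _] at h⟩)
  obtain ⟨g, hg, hgp⟩ := hirr p hp01.1 hp01.2
  exact hgp (hpfix g hg)

end HeightHomeo
end
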